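/- Let ℂ² have basis e_{-1}, e_1 with matrix units E_{ij} (i,j ∈ {-1,1}). On ℂ²⊗ℂ² set P° = Σ_{i,j} E_{ij}⊗E_{ji} and R°(u) = I − P°/u. Then the following absorption identities for the projector ½R°(−1) = ½(I+P°) hold as identities of rational functions in u: (i) ½R°(−1)·R°(2)^{t_-} = ½R°(−1); (ii) ½R°(−1)·R°(−4u+1)^{t_-} = ½R°(−1); and (iii) R°(4u)·½R°(−1) = ((4u−1)/(4u))·½R°(−1), where for an operator X on ℂ²⊗ℂ², X^{t_-} denotes the partial transpose t_- applied to the first tensor factor, with M^{t_-} = Σ sign(i)sign(j) M_{ij} E_{-j,-i} for a 2×2 matrix M. -/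

import Mathlib

open Matrix Kronecker Finset

noncomputable section

/-- The index set `I_N` as a subtype of `ℤ` determined by a finite set `S ⊆ ℤ`. -/
abbrev Idx (S : Finset ℤ) : Type := {i : ℤ // i ∈ S}

/-- The matrix unit `E_{ab}` of `End(ℂ^N)` (zero if `a` or `b` is not in the index set). -/
def Emat (S : Finset ℤ) (a b : ℤ) : Matrix (Idx S) (Idx S) ℂ :=
  fun p q => if ((p : ℤ) = a ∧ (q : ℤ) = b) then 1 else 0

/-- The permutation operator `P = Σ_{i,j} E_{ij} ⊗ E_{ji}` on `ℂ^N ⊗ ℂ^N`. -/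
def Pmat (S : Finset ℤ) : Matrix (Idx S × Idx S) (Idx S × Idx S) ℂ :=
  ∑ i ∈ S, ∑ j ∈ S, Emat S i j ⊗ₖ Emat S j i

/-- The operator `Q = Σ_{i,j} θ_{ij} E_{ij} ⊗ E_{-i,-j}` on `ℂ^N ⊗ ℂ^N`. -/
def Qmat (S : Finset ℤ) (θ : ℤ → ℤ → ℂ) : Matrix (Idx S × Idx S) (Idx S × Idx S) ℂ :=
  ∑ i ∈ S, ∑ j ∈ S, θ i j • (Emat S i j ⊗ₖ Emat S (-i) (-j))

/-- The R-matrix `R(u) = I - P/u + Q/(u - κ)` of types B, C, D. -/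
def Rmat (S : Finset ℤ) (θ : ℤ → ℤ → ℂ) (κ u : ℂ) :
    Matrix (Idx S × Idx S) (Idx S × Idx S) ℂ :=
  1 - u⁻¹ • Pmat S + (u - κ)⁻¹ • Qmat S θ

/-- `θ_{ij} = 1` (orthogonal case). -/
def θorth : ℤ → ℤ → ℂ := fun _ _ => 1

/-- `θ_{ij} = sign(i)·sign(j)` (symplectic case). -/
def θsymp : ℤ → ℤ → ℂ := fun i j =>
  (if 0 < i then (1 : ℂ) else -1) * (if 0 < j then (1 : ℂ) else -1)

/-- The two-element index set `{-1, 1}` for `ℂ²`. -/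
def S2 : Finset ℤ := {-1, 1}

abbrev V2 : Type := Idx S2

/-- Negation `i ↦ -i` on the index set `{-1, 1}`. -/
def nneg (p : V2) : V2 :=
  ⟨-(p : ℤ), by
    have h := p.2
    simp only [S2, Finset.mem_insert, Finset.mem_singleton] at h ⊢
    omega⟩

/-- The rational R-matrix `R°(u) = I - P°/u` of type A on `ℂ² ⊗ ℂ²`. -/
def Ro (u : ℂ) : Matrix (V2 × V2) (V2 × V2) ℂ := 1 - u⁻¹ • Pmat S2

/-- `sign(i)` for `i ∈ {-1, 1}`. -/
def ssgn : V2 → ℂ := fun i => if 0 < (i : ℤ) then 1 else -1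

/-- Partial transpose applied to the first tensor factor of `ℂ² ⊗ ℂ²`, for the transpose
`M ↦ Σ_{i,j} s(i) s(j) M_{ij} E_{-j,-i}` of `2 × 2` matrices (take `s ≡ 1` for `t₊` and
`s = sign` for `t₋`). -/
def pt1 (s : V2 → ℂ) (X : Matrix (V2 × V2) (V2 × V2) ℂ) :
    Matrix (V2 × V2) (V2 × V2) ℂ :=
  fun p q => s p.1 * s q.1 * X (nneg q.1, p.2) (nneg p.1, q.2)

/-- The projector `½R°(-1) = ½(I + P°)` on `ℂ² ⊗ ℂ²`. -/
def halfR : Matrix (V2 × V2) (V2 × V2) ℂ := (2 : ℂ)⁻¹ • Ro (-1)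

lemma Pmat_apply (S : Finset ℤ) (p q : Idx S × Idx S) :
    Pmat S p q = if p.1 = q.2 ∧ p.2 = q.1 then 1 else 0 := by
  simp only [Pmat, Matrix.sum_apply, Matrix.kroneckerMap_apply, Emat]
  rw [Finset.sum_eq_single_of_mem (p.1 : ℤ) p.1.2, Finset.sum_eq_single_of_mem (q.1 : ℤ) q.1.2]
  · simp only [Subtype.ext_iff, and_self, if_true, one_mul]
    exact if_congr (by rw [and_comm, eq_comm (a := (q.2 : ℤ))]) rfl rfl
  · intro j _ hj
    simp [hj.symm]
  · intro i _ hi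
    simp [hi.symm]

lemma Pmat_mul_apply (S : Finset ℤ) (X : Matrix (Idx S × Idx S) (Idx S × Idx S) ℂ)
    (p q : Idx S × Idx S) : (Pmat S * X) p q = X p.swap q := by
  rw [Matrix.mul_apply, Finset.sum_eq_single_of_mem p.swap (Finset.mem_univ _)]
  · simp [Pmat_apply]
  · intro r _ hr
    rw [Pmat_apply, if_neg, zero_mul]
    rintro ⟨h₁, h₂⟩
    exact hr (Prod.ext h₂.symm h₁.symm)

lemma Pmat_mul_self (S : Finset ℤ) : Pmat S * Pmat S = 1 := by
  ext p q
  rw [Pmat_mul_apply, Pmat_apply, Matrix.one_apply]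
  exact if_congr (by rw [Prod.ext_iff, and_comm]; rfl) rfl rfl

lemma nneg_injective : Function.Injective nneg := fun _ _ h =>
  Subtype.ext (neg_injective (congrArg Subtype.val h))

lemma ssgn_mul_self (p : V2) : ssgn p * ssgn p = 1 := by
  unfold ssgn
  split_ifs <;> norm_num

lemma ssgn_nneg (p : V2) : ssgn (nneg p) = -ssgn p := by
  obtain ⟨p, hp⟩ := p
  simp only [S2, Finset.mem_insert, Finset.mem_singleton] at hp
  rcases hp with rfl | rfl <;> norm_num [ssgn, nneg]

lemma eq_nneg_comm {p q : V2} : p = nneg q ↔ q = nneg p := by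
  simp only [nneg, Subtype.ext_iff]
  omega

lemma pt1_ssgn_one : pt1 ssgn 1 = 1 := by
  ext p q
  simp only [pt1, Matrix.one_apply, Prod.ext_iff, nneg_injective.eq_iff]
  by_cases h : p.1 = q.1
  · simp [h, ssgn_mul_self]
  · simp [h, Ne.symm h]

lemma pt1_Ro (s : V2 → ℂ) (v : ℂ) : pt1 s (Ro v) = pt1 s 1 - v⁻¹ • pt1 s (Pmat S2) := by
  ext p q
  simp only [pt1, Ro, Matrix.sub_apply, Matrix.smul_apply, smul_eq_mul]
  ring

/-- The partial transpose of `P` has image spanned by an antisymmetric vector. -/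
lemma Pmat_mul_pt1_ssgn_Pmat : Pmat S2 * pt1 ssgn (Pmat S2) = -pt1 ssgn (Pmat S2) := by
  ext p q
  rw [Pmat_mul_apply, Matrix.neg_apply]
  simp only [pt1, Pmat_apply, Prod.fst_swap, Prod.snd_swap]
  simp only [eq_nneg_comm (p := p.1) (q := p.2)]
  by_cases h : p.2 = nneg p.1
  · rw [h, ssgn_nneg]
    ring
  · simp [h]

lemma halfR_eq : halfR = (2 : ℂ)⁻¹ • (1 + Pmat S2) := by
  simp [halfR, Ro, inv_neg]

lemma halfR_mul_pt1_ssgn_Ro (v : ℂ) : halfR * pt1 ssgn (Ro v) = halfR := by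
  rw [halfR_eq, pt1_Ro, pt1_ssgn_one, smul_mul_assoc, mul_sub, mul_one, mul_smul_comm, add_mul,
    one_mul, Pmat_mul_pt1_ssgn_Pmat, add_neg_cancel, smul_zero, sub_zero]

lemma Ro_mul_halfR (v : ℂ) : Ro v * halfR = (1 - v⁻¹) • halfR := by
  rw [halfR_eq, Ro, mul_smul_comm, sub_mul, one_mul, smul_mul_assoc, mul_add, mul_one,
    Pmat_mul_self, add_comm (Pmat S2), smul_comm, sub_smul, one_smul]

/-- the absorption identities
(i) `½R°(-1)·R°(2)^{t₋} = ½R°(-1)`;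
(ii) `½R°(-1)·R°(-4u+1)^{t₋} = ½R°(-1)`;
(iii) `R°(4u)·½R°(-1) = ((4u-1)/(4u))·½R°(-1)`. -/
theorem half_R_absorption (u : ℂ) (hu0 : u ≠ 0) (hu1 : 4 * u ≠ 1) :
    halfR * pt1 ssgn (Ro 2) = halfR ∧
    halfR * pt1 ssgn (Ro (-4 * u + 1)) = halfR ∧
    Ro (4 * u) * halfR = ((4 * u - 1) / (4 * u)) • halfR := by
  refine ⟨halfR_mul_pt1_ssgn_Ro 2, halfR_mul_pt1_ssgn_Ro _, ?_⟩
  rw [Ro_mul_halfR, sub_div, div_self (mul_ne_zero (by norm_num) hu0), one_div]
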